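/- arXiv:1511.00406 — 2 statements merged into one kernel-verified Lean document; each statement's English description precedes it below -/
import Mathlib

section
/- Let R be a commutative ring and M an R-module. Then the quotient ring End_R(R ⊕ M)/[M] is isomorphic, as an R-algebra, to R/τ(M), where τ(M) ⊆ R is the trace ideal of M, namely the ideal generated by all elements f(m) with f ∈ Hom_R(M, R) and m ∈ M. In particular, End_R(R ⊕ M)/[M] is a commutative ring. -/
/-- The set of endomorphisms of `E` that factor through a finite direct sum of copies of `N`. -/
def factorsThroughSet (A : Type*) [Ring A] (N E : Type*) [AddCommGroup N] [AddCommGroup E]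
    [Module A N] [Module A E] : Set (Module.End A E) :=
  {f | ∃ (k : ℕ) (g : E →ₗ[A] (Fin k → N)) (h : (Fin k → N) →ₗ[A] E), f = h.comp g}

/-- The two-sided ideal `[N]` of `End_A(E)` of endomorphisms factoring through finite
direct sums of copies of `N`. -/
def factorIdeal (A : Type*) [Ring A] (N E : Type*) [AddCommGroup N] [AddCommGroup E]
    [Module A N] [Module A E] : TwoSidedIdeal (Module.End A E) :=
  TwoSidedIdeal.span (factorsThroughSet A N E)

/-- The trace ideal of an `R`-module `M`: the ideal generated by all `f m` for
`f : M →ₗ[R] R` and `m : M`. -/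
def traceIdeal (R : Type*) [CommRing R] (M : Type*) [AddCommGroup M] [Module R M] : Ideal R :=
  Ideal.span {x | ∃ (f : M →ₗ[R] R) (m : M), f m = x}

lemma mem_factorIdeal_of_comp {R : Type*} [CommRing R] {M E : Type*} [AddCommGroup M]
    [AddCommGroup E] [Module R M] [Module R E] (g : E →ₗ[R] M) (h : M →ₗ[R] E) :
    (h.comp g : Module.End R E) ∈ factorIdeal R M E := by
  apply TwoSidedIdeal.subset_span
  exact ⟨1, LinearMap.pi (fun _ => g), h.comp (LinearMap.proj 0), by ext; simp⟩

lemma apply_mem_traceIdeal {R : Type*} [CommRing R] {M : Type*} [AddCommGroup M]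
    [Module R M] (f : M →ₗ[R] R) (m : M) : f m ∈ traceIdeal R M :=
  Ideal.subset_span ⟨f, m, rfl⟩

/-- The corner map `f ↦ f₁₁ mod τ(M)`. -/
noncomputable def cornerHom (R : Type*) [CommRing R] (M : Type*) [AddCommGroup M] [Module R M] :
    Module.End R (R × M) →+* R ⧸ traceIdeal R M where
  toFun f := Ideal.Quotient.mk _ (f (1, 0)).1
  map_one' := by simp
  map_zero' := by simp
  map_add' f g := by simp
  map_mul' f g := by
    rw [← map_mul, Ideal.Quotient.eq]
    have h : g (1, 0) = (g (1, 0)).1 • ((1 : R), (0 : M)) + (0, (g (1, 0)).2) := by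
      ext <;> simp
    have h2 : ((f * g) (1, 0)).1 - (f (1, 0)).1 * (g (1, 0)).1
        = ((LinearMap.fst R R M).comp (f.comp (LinearMap.inr R R M))) (g (1, 0)).2 := by
      rw [Module.End.mul_apply]
      conv_lhs => enter [1]; rw [h]
      rw [map_add, map_smul]
      simp
      ring
    rw [h2]
    exact apply_mem_traceIdeal _ _

lemma cornerHom_apply {R : Type*} [CommRing R] {M : Type*} [AddCommGroup M] [Module R M]
    (f : Module.End R (R × M)) :
    cornerHom R M f = Ideal.Quotient.mk (traceIdeal R M) (f (1, 0)).1 := rfl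

lemma factorIdeal_le_ker (R : Type*) [CommRing R] (M : Type*) [AddCommGroup M] [Module R M] :
    factorIdeal R M (R × M) ≤ TwoSidedIdeal.ker (cornerHom R M) := by
  refine TwoSidedIdeal.span_le.2 ?_
  rintro _ ⟨k, g, h, rfl⟩
  rw [SetLike.mem_coe, TwoSidedIdeal.mem_ker, cornerHom_apply, Ideal.Quotient.eq_zero_iff_mem]
  have : (h.comp g (1, 0)).1 = ∑ i, ((LinearMap.fst R R M).comp
      (h.comp (LinearMap.single R (fun _ : Fin k => M) i))) (g (1, 0) i) := by
    simp only [LinearMap.comp_apply, LinearMap.coe_single]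
    rw [← map_sum, ← map_sum, Finset.univ_sum_single]
    rfl
  rw [this]
  exact Ideal.sum_mem _ fun i _ => apply_mem_traceIdeal _ _

lemma algebraMap_mem_factorIdeal {R : Type*} [CommRing R] {M : Type*} [AddCommGroup M] [Module R M]
    {a : R} (ha : a ∈ traceIdeal R M) :
    algebraMap R (Module.End R (R × M)) a ∈ factorIdeal R M (R × M) := by
  refine Submodule.span_induction ?_ ?_ ?_ ?_ ha
  · rintro _ ⟨f, m, rfl⟩
    have : algebraMap R (Module.End R (R × M)) (f m) =
        ((LinearMap.inl R R M).comp f).comp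
          ((LinearMap.toSpanSingleton R M m).comp (LinearMap.fst R R M)) +
        (f m • LinearMap.inr R R M).comp (LinearMap.snd R R M) := by
      ext <;> simp [Module.algebraMap_end_apply]
    rw [this]
    exact add_mem (mem_factorIdeal_of_comp _ _) (mem_factorIdeal_of_comp _ _)
  · rw [map_zero]; exact zero_mem _
  · intro x y _ _ hx hy
    rw [map_add]; exact add_mem hx hy
  · intro r x _ hx
    rw [smul_eq_mul, map_mul]
    exact TwoSidedIdeal.mul_mem_left _ _ _ hx

lemma sub_mem_factorIdeal {R : Type*} [CommRing R] {M : Type*} [AddCommGroup M] [Module R M]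
    (f : Module.End R (R × M)) :
    f - algebraMap R (Module.End R (R × M)) (f (1, 0)).1 ∈ factorIdeal R M (R × M) := by
  have : f - algebraMap R (Module.End R (R × M)) (f (1, 0)).1 =
      (LinearMap.inr R R M).comp
        ((LinearMap.snd R R M).comp (f.comp ((LinearMap.inl R R M).comp (LinearMap.fst R R M)))) +
      ((f - algebraMap R (Module.End R (R × M)) (f (1, 0)).1).comp
        (LinearMap.inr R R M)).comp (LinearMap.snd R R M) := by
    have h0 : f ((0 : R), (0 : M)) = 0 := map_zero f
    ext <;> simp [Module.algebraMap_end_apply, h0]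
  rw [this]
  exact add_mem (mem_factorIdeal_of_comp _ _) (mem_factorIdeal_of_comp _ _)

lemma mem_factorIdeal_iff {R : Type*} [CommRing R] {M : Type*} [AddCommGroup M] [Module R M]
    (f : Module.End R (R × M)) :
    f ∈ factorIdeal R M (R × M) ↔ cornerHom R M f = 0 := by
  refine ⟨fun h => (TwoSidedIdeal.mem_ker _).1 (factorIdeal_le_ker R M h), fun h => ?_⟩
  rw [cornerHom_apply, Ideal.Quotient.eq_zero_iff_mem] at h
  simpa using add_mem (sub_mem_factorIdeal f) (algebraMap_mem_factorIdeal h)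

lemma ringCon_iff {R : Type*} [CommRing R] {M : Type*} [AddCommGroup M] [Module R M]
    (f g : Module.End R (R × M)) :
    (factorIdeal R M (R × M)).ringCon f g ↔ cornerHom R M f = cornerHom R M g := by
  rw [TwoSidedIdeal.rel_iff, mem_factorIdeal_iff, map_sub, sub_eq_zero]

/-- `End_R(R ⊕ M)/[M]` is isomorphic as an `R`-algebra to `R/τ(M)` where `τ(M)`
is the trace ideal of `M`; in particular `End_R(R ⊕ M)/[M]` is commutative. -/
theorem stmt3 (R : Type*) [CommRing R] (M : Type*) [AddCommGroup M] [Module R M] :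
    (∃ e : (factorIdeal R M (R × M)).ringCon.Quotient ≃+* R ⧸ traceIdeal R M,
      ∀ r : R, e ((factorIdeal R M (R × M)).ringCon.mk'
          (algebraMap R (Module.End R (R × M)) r)) = Ideal.Quotient.mk (traceIdeal R M) r) ∧
    ∀ x y : (factorIdeal R M (R × M)).ringCon.Quotient, x * y = y * x := by
  have key : ∃ e : (factorIdeal R M (R × M)).ringCon.Quotient ≃+* R ⧸ traceIdeal R M,
      ∀ r : R, e ((factorIdeal R M (R × M)).ringCon.mk'
          (algebraMap R (Module.End R (R × M)) r)) = Ideal.Quotient.mk (traceIdeal R M) r := by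
    let φ : (factorIdeal R M (R × M)).ringCon.Quotient →+* R ⧸ traceIdeal R M :=
      (factorIdeal R M (R × M)).ringCon.lift (cornerHom R M)
        (fun f g h => (ringCon_iff f g).1 h)
    have hφ : ∀ f, φ ((factorIdeal R M (R × M)).ringCon.mk' f) = cornerHom R M f := fun f => rfl
    have hr : ∀ r : R, φ ((factorIdeal R M (R × M)).ringCon.mk'
          (algebraMap R (Module.End R (R × M)) r)) = Ideal.Quotient.mk (traceIdeal R M) r := by
      intro r
      rw [hφ, cornerHom_apply]
      simp [Module.algebraMap_end_apply]
    have hb : Function.Bijective φ := by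
      constructor
      · intro x y hxy
        obtain ⟨f, rfl⟩ := RingCon.mk'_surjective _ x
        obtain ⟨g, rfl⟩ := RingCon.mk'_surjective _ y
        exact (RingCon.eq _).2 ((ringCon_iff f g).2 hxy)
      · intro y
        obtain ⟨r, rfl⟩ := Ideal.Quotient.mk_surjective y
        exact ⟨_, hr r⟩
    exact ⟨RingEquiv.ofBijective φ hb, hr⟩
  refine ⟨key, fun x y => ?_⟩
  obtain ⟨e, -⟩ := key
  apply e.injective
  rw [map_mul, map_mul, mul_comm]
end

section
/- Let R be a commutative Noetherian ring and M a finitely generated R-module. Then for every prime ideal p of R, the localization at p of End_R(R ⊕ M)/[R] is zero if and only if M_p is a free R_p-module. Consequently, the support of the finitely generated R-module End_R(R ⊕ M)/[R] is exactly the set of prime ideals p of R at which M_p is not free. -/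
/-- The quotient of an `S`-algebra by a ring congruence is an `S`-algebra. -/
noncomputable def RingCon.quotientAlgebra' {S A : Type*} [CommSemiring S] [Semiring A]
    [Algebra S A] (c : RingCon A) : Algebra S c.Quotient :=
  RingHom.toAlgebra'
    ((c.mk' : A →+* c.Quotient).comp (algebraMap S A))
    (fun s x => by
      induction x using Quotient.ind with
      | _ y => exact congrArg c.toQuotient (Algebra.commutes s y))

theorem mem_factorIdeal_iff_s6 (A : Type*) [Ring A] (N E : Type*) [AddCommGroup N]
    [AddCommGroup E] [Module A N] [Module A E] (f : Module.End A E) :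
    f ∈ factorIdeal A N E ↔ f ∈ factorsThroughSet A N E := by
  constructor
  · intro hf
    refine TwoSidedIdeal.span_induction (p := fun x _ => x ∈ factorsThroughSet A N E)
      (fun x hx => hx) ?_ ?_ ?_ ?_ ?_ hf
    · exact ⟨0, 0, 0, by simp⟩
    · rintro x y - - ⟨k, g, h, rfl⟩ ⟨k', g', h', rfl⟩
      let e : (Fin (k + k') → N) ≃ₗ[A] (Fin k → N) × (Fin k' → N) :=
        (LinearEquiv.funCongrLeft A N finSumFinEquiv).trans
          (LinearEquiv.sumArrowLequivProdArrow (Fin k) (Fin k') A N)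
      refine ⟨k + k', e.symm.toLinearMap ∘ₗ g.prod g', h.coprod h' ∘ₗ e.toLinearMap, ?_⟩
      ext x
      simp
    · rintro x - ⟨k, g, h, rfl⟩
      exact ⟨k, g, -h, by ext; simp⟩
    · rintro a x - ⟨k, g, h, rfl⟩
      exact ⟨k, g, a ∘ₗ h, by ext; simp⟩
    · rintro a x - ⟨k, g, h, rfl⟩
      exact ⟨k, g ∘ₗ a, h, by ext; simp⟩
  · exact fun h => TwoSidedIdeal.subset_span h

theorem smul_mem_factorIdeal_iff (R : Type*) [CommRing R] (M : Type*) [AddCommGroup M]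
    [Module R M] (r : R) :
    algebraMap R (Module.End R (R × M)) r ∈ factorIdeal R R (R × M) ↔
      ∃ (k : ℕ) (g : M →ₗ[R] (Fin k → R)) (h : (Fin k → R) →ₗ[R] M),
        r • LinearMap.id = h ∘ₗ g := by
  constructor
  · rw [mem_factorIdeal_iff_s6]
    rintro ⟨k, g, h, H⟩
    refine ⟨k, g ∘ₗ LinearMap.inr R R M, LinearMap.snd R R M ∘ₗ h, ?_⟩
    ext x
    have := congrArg Prod.snd (LinearMap.congr_fun H (0, x))
    simpa using this
  · rintro ⟨k, g, h, H⟩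
    have h1 : LinearMap.inr R R M ∘ₗ (h ∘ₗ g) ∘ₗ LinearMap.snd R R M
        ∈ factorIdeal R R (R × M) :=
      (mem_factorIdeal_iff_s6 _ _ _ _).2
        ⟨k, g ∘ₗ LinearMap.snd R R M, LinearMap.inr R R M ∘ₗ h, rfl⟩
    have h2 : LinearMap.inl R R M ∘ₗ (r • LinearMap.id) ∘ₗ LinearMap.fst R R M
        ∈ factorIdeal R R (R × M) :=
      (mem_factorIdeal_iff_s6 _ _ _ _).2
        ⟨1, (LinearEquiv.funUnique (Fin 1) R R).symm.toLinearMap ∘ₗ LinearMap.fst R R M,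
          LinearMap.inl R R M ∘ₗ (r • LinearMap.id) ∘ₗ
            (LinearEquiv.funUnique (Fin 1) R R).toLinearMap, by ext <;> simp⟩
    have h3 := TwoSidedIdeal.add_mem _ h1 h2
    rw [← H] at h3
    convert h3 using 1
    ext <;> simp

theorem free_iff_exists_factor (R : Type*) [CommRing R] [IsNoetherianRing R]
    (M : Type*) [AddCommGroup M] [Module R M] [Module.Finite R M] (p : Ideal R) [p.IsPrime] :
    (∃ r ∈ p.primeCompl, ∃ (k : ℕ) (g : M →ₗ[R] (Fin k → R)) (h : (Fin k → R) →ₗ[R] M),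
        r • LinearMap.id = h ∘ₗ g) ↔
      Module.Free (Localization p.primeCompl) (LocalizedModule p.primeCompl M) := by
  constructor
  · rintro ⟨r, hr, k, g, h, H⟩
    have hu : IsUnit (algebraMap R (Localization p.primeCompl) r) :=
      IsLocalization.map_units (M := p.primeCompl) _ ⟨r, hr⟩
    obtain ⟨u, hu⟩ := hu
    have hc : ∀ x, LocalizedModule.map p.primeCompl h (LocalizedModule.map p.primeCompl g x)
        = (u : Localization p.primeCompl) • x := by
      intro x
      induction x using LocalizedModule.induction_on with
      | h m s =>
        have := LinearMap.congr_fun H m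
        simp only [LinearMap.smul_apply, LinearMap.id_apply, LinearMap.comp_apply] at this
        rw [LocalizedModule.map_mk, LocalizedModule.map_mk, ← this, hu, algebraMap_smul,
          LocalizedModule.smul'_mk]
    have : Module.Projective (Localization p.primeCompl) (LocalizedModule p.primeCompl M) := by
      refine Module.Projective.of_split (LocalizedModule.map p.primeCompl g)
        ((↑u⁻¹ : Localization p.primeCompl) • LocalizedModule.map p.primeCompl h) ?_
      ext x
      simp only [LinearMap.comp_apply, LinearMap.smul_apply, hc, LinearMap.id_apply, smul_smul,
        Units.inv_mul, one_smul]
    have : IsLocalRing (Localization p.primeCompl) :=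
      inferInstanceAs (IsLocalRing (Localization.AtPrime p))
    exact Module.free_of_flat_of_isLocalRing
  · intro hF
    have : Nontrivial (Localization p.primeCompl) :=
      inferInstanceAs (Nontrivial (Localization.AtPrime p))
    have hfp : Module.FinitePresentation R M := Module.finitePresentation_of_finite R M
    let b := Module.finBasis (Localization p.primeCompl) (LocalizedModule p.primeCompl M)
    let n := Module.finrank (Localization p.primeCompl) (LocalizedModule p.primeCompl M)
    let e : LocalizedModule p.primeCompl M ≃ₗ[R] (Fin n → Localization p.primeCompl) :=
      b.equivFun.restrictScalars R
    let m := LocalizedModule.mkLinearMap p.primeCompl M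
    let a : (Fin n → R) →ₗ[R] (Fin n → Localization p.primeCompl) :=
      LinearMap.pi fun i => Algebra.linearMap R _ ∘ₗ LinearMap.proj i
    have ha : IsLocalizedModule p.primeCompl a := inferInstance
    obtain ⟨g, s, hg⟩ := Module.FinitePresentation.exists_lift_of_isLocalizedModule
      p.primeCompl a (e.toLinearMap ∘ₗ m)
    obtain ⟨h, t, hh⟩ := Module.FinitePresentation.exists_lift_of_isLocalizedModule
      p.primeCompl m (e.symm.toLinearMap ∘ₗ a)
    have key : m ∘ₗ (h ∘ₗ g) = m ∘ₗ ((t * s) • LinearMap.id) := by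
      ext x
      have h1 := LinearMap.congr_fun hh (g x)
      have h2 := LinearMap.congr_fun hg x
      simp only [LinearMap.smul_apply, LinearMap.comp_apply, LinearEquiv.coe_coe] at h1 h2
      simp only [LinearMap.smul_apply, LinearMap.comp_apply, LinearMap.id_apply]
      rw [h1, h2, Submonoid.smul_def, Submonoid.smul_def, Submonoid.smul_def, map_smul,
        LinearEquiv.symm_apply_apply, map_smul, smul_smul, Submonoid.coe_mul]
    obtain ⟨v, hv⟩ := Module.Finite.exists_smul_of_comp_eq_of_isLocalizedModule
      p.primeCompl m _ _ key
    refine ⟨v * (t * s), (v * (t * s)).2, n, g, v • h, ?_⟩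
    rw [LinearMap.smul_comp, hv]
    ext x
    simp [Submonoid.smul_def, mul_smul]

theorem subsingleton_iff_free (R : Type*) [CommRing R] [IsNoetherianRing R]
    (M : Type*) [AddCommGroup M] [Module R M] [Module.Finite R M] (p : Ideal R) [p.IsPrime] :
    letI : Algebra R ((factorIdeal R R (R × M)).ringCon.Quotient) :=
      (factorIdeal R R (R × M)).ringCon.quotientAlgebra'
    Subsingleton
        (LocalizedModule p.primeCompl ((factorIdeal R R (R × M)).ringCon.Quotient)) ↔
      Module.Free (Localization p.primeCompl) (LocalizedModule p.primeCompl M) := by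
  letI alg : Algebra R ((factorIdeal R R (R × M)).ringCon.Quotient) :=
    (factorIdeal R R (R × M)).ringCon.quotientAlgebra'
  rw [← free_iff_exists_factor, LocalizedModule.subsingleton_iff]
  simp_rw [← smul_mem_factorIdeal_iff]
  have hz : ∀ r : R, algebraMap R (factorIdeal R R (R × M)).ringCon.Quotient r = 0 ↔
      algebraMap R (Module.End R (R × M)) r ∈ factorIdeal R R (R × M) := by
    intro r
    rw [TwoSidedIdeal.mem_iff]
    exact RingCon.eq _
  constructor
  · intro H
    obtain ⟨r, hr, h⟩ := H 1
    refine ⟨r, hr, (hz r).1 ?_⟩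
    rwa [Algebra.smul_def, mul_one] at h
  · rintro ⟨r, hr, h⟩ m
    refine ⟨r, hr, ?_⟩
    rw [Algebra.smul_def, (hz r).2 h, zero_mul]

/-- for a commutative Noetherian ring `R` and a finitely generated `R`-module
`M`, the localization at a prime `p` of `Q := End_R(R ⊕ M)/[R]` vanishes iff `M_p` is a free
`R_p`-module; consequently the support of `Q` is exactly the non-free locus of `M`. -/
theorem stmt6 (R : Type*) [CommRing R] [IsNoetherianRing R]
    (M : Type*) [AddCommGroup M] [Module R M] [Module.Finite R M] :
    letI : Algebra R ((factorIdeal R R (R × M)).ringCon.Quotient) :=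
      (factorIdeal R R (R × M)).ringCon.quotientAlgebra'
    (∀ (p : Ideal R) [p.IsPrime],
      Subsingleton
        (LocalizedModule p.primeCompl ((factorIdeal R R (R × M)).ringCon.Quotient)) ↔
      Module.Free (Localization p.primeCompl) (LocalizedModule p.primeCompl M)) ∧
    Module.support R ((factorIdeal R R (R × M)).ringCon.Quotient) =
      {p : PrimeSpectrum R |
        ¬ Module.Free (Localization p.asIdeal.primeCompl)
            (LocalizedModule p.asIdeal.primeCompl M)} := by
  letI alg : Algebra R ((factorIdeal R R (R × M)).ringCon.Quotient) :=
    (factorIdeal R R (R × M)).ringCon.quotientAlgebra'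
  refine ⟨fun p _ => subsingleton_iff_free R M p, ?_⟩
  ext p
  rw [Set.mem_setOf_eq, ← subsingleton_iff_free R M p.asIdeal, ← Module.notMem_support_iff,
    not_not]
end
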